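/- Karamata representation for the Weibull domain: a distribution function F belongs to D(ψ_γ) for some γ > 0 if and only if its upper endpoint x₀(F) = sup{x : F(x) < 1} is finite and there exist a constant c > 0 and measurable functions f, b : (0,1) → ℝ with f(u) → 0 and b(u) → 0 as u → 0+, such that t ↦ b(t)/t is integrable on (u,1) for every u ∈ (0,1) and, for all 0 < u < 1, x₀(F) − F⁻¹(1 − u) = c (1 + f(u)) u^{1/γ} exp(∫_u^1 b(t) t^{−1} dt). -/

import Mathlib

open MeasureTheory Filter Topology Set

noncomputable section

/-- A distribution function: nondecreasing, right-continuous, with limits 0 at -∞ and 1 at +∞. -/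
def IsDF (F : ℝ → ℝ) : Prop :=
  Monotone F ∧ (∀ x, ContinuousWithinAt F (Set.Ici x) x) ∧
    Tendsto F atBot (𝓝 0) ∧ Tendsto F atTop (𝓝 1)

/-- `F` lies in the domain of attraction of `M`. -/
def MemDomAttr (F M : ℝ → ℝ) : Prop :=
  ∃ a b : ℕ → ℝ, (∀ n, 0 < a n) ∧
    ∀ x, ContinuousAt M x →
      Tendsto (fun n => F (a n * x + b n) ^ n) atTop (𝓝 (M x))

/-- The Gumbel distribution function Λ. -/
def gumbelDF (x : ℝ) : ℝ := Real.exp (-Real.exp (-x))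

/-- The Fréchet distribution function φ_γ. -/
def frechetDF (γ : ℝ) (x : ℝ) : ℝ := if 0 < x then Real.exp (-(x ^ (-γ))) else 0

/-- The Weibull distribution function ψ_γ. -/
def weibullDF (γ : ℝ) (x : ℝ) : ℝ := if x < 0 then Real.exp (-((-x) ^ γ)) else 1

/-- Generalized inverse `F⁻¹(u) = inf {x | F x ≥ u}`. -/
def genInv (F : ℝ → ℝ) (u : ℝ) : ℝ := sInf {x | u ≤ F x}

/-- Upper endpoint `x₀(F) = sup {x | F x < 1}`. -/
def upEnd (F : ℝ → ℝ) : ℝ := sSup {x | F x < 1}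

/-- Membership in `D(φ) = ⋃_{γ>0} D(φ_γ)`. -/
def MemFrechetDom (F : ℝ → ℝ) : Prop := ∃ γ, 0 < γ ∧ MemDomAttr F (frechetDF γ)

/-- Membership in `D(ψ) = ⋃_{γ>0} D(ψ_γ)`. -/
def MemWeibullDom (F : ℝ → ℝ) : Prop := ∃ γ, 0 < γ ∧ MemDomAttr F (weibullDF γ)

/-- Membership in `Γ = D(Λ) ∪ D(φ) ∪ D(ψ)`. -/
def MemGamma (F : ℝ → ℝ) : Prop :=
  MemDomAttr F gumbelDF ∨ MemFrechetDom F ∨ MemWeibullDom F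

/-- Iterated integral `x ↦ ∫_x^z dy_1 ∫_{y_1}^z ⋯ ∫_{y_p}^z (1 - H t) dt`. -/
def iterInt (H : ℝ → ℝ) (z : ℝ) : ℕ → ℝ → ℝ
  | 0 => fun x => ∫ t in x..z, (1 - H t)
  | (p + 1) => fun x => ∫ y in x..z, iterInt H z p y

/-- `Rp p x z H` is `R_p(x, z, H)` (for `p ≥ 1`). -/
def Rp (p : ℕ) (x z : ℝ) (H : ℝ → ℝ) : ℝ := (1 - H x)⁻¹ * iterInt H z (p - 1) x

/-- Iterated integral with upper endpoint `x₀(H)` (handled as an integral up to +∞,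
since `1 - H` vanishes beyond the upper endpoint). -/
def iterIntInf (H : ℝ → ℝ) : ℕ → ℝ → ℝ
  | 0 => fun x => ∫ t in Set.Ioi x, (1 - H t)
  | (p + 1) => fun x => ∫ y in Set.Ioi x, iterIntInf H p y

/-- `RpInf p x H` is `R_p(x, H) = R_p(x, x₀(H), H)` (for `p ≥ 1`). -/
def RpInf (p : ℕ) (x : ℝ) (H : ℝ → ℝ) : ℝ := (1 - H x)⁻¹ * iterIntInf H (p - 1) x

/-- Regular variation at zero with exponent `d`. -/
def RegVarAtZero (s : ℝ → ℝ) (d : ℝ) : Prop :=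
  ∀ l : ℝ, 0 < l → Tendsto (fun u => s (l * u) / s u) (𝓝[>] (0 : ℝ)) (𝓝 (l ^ d))

/-- `orderStat n j v`: the `j`-th smallest (1-indexed) among `v 0, …, v (n-1)`. -/
def orderStat (n j : ℕ) (v : ℕ → ℝ) : ℝ :=
  ((Multiset.map v (Multiset.range n)).sort (· ≤ ·)).getD (j - 1) 0

/-- Cumulative distribution function of the centered Gaussian law with variance `v`. -/
def gaussCdf (v : ℝ) (x : ℝ) : ℝ :=
  ((ProbabilityTheory.gaussianReal 0 v.toNNReal) (Set.Iic x)).toReal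


open Classical in
/-- The filter "x → x₀(G)⁻" of approach to the upper endpoint from below
(`atTop` when the upper endpoint is infinite). -/
def upEndFilter (G : ℝ → ℝ) : Filter ℝ :=
  if BddAbove {x | G x < 1} then 𝓝[<] (upEnd G) else atTop



lemma genInv_le_iff {F : ℝ → ℝ} (hF : IsDF F) {p : ℝ} (h0 : 0 < p) (h1 : p < 1) (x : ℝ) :
    genInv F p ≤ x ↔ p ≤ F x := by
  obtain ⟨hm, hr, hb, ht⟩ := hF
  have hbdd : BddBelow {x | p ≤ F x} := by
    obtain ⟨y, hy⟩ := (hb.eventually (gt_mem_nhds h0)).exists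
    refine ⟨y, fun z hz => ?_⟩
    by_contra hlt
    push Not at hlt
    exact absurd (hm hlt.le) (not_le.2 (lt_of_lt_of_le hy hz))
  have hne : {x | p ≤ F x}.Nonempty := by
    obtain ⟨y, hy⟩ := (ht.eventually (lt_mem_nhds h1)).exists
    exact ⟨y, hy.le⟩
  constructor
  · intro h
    by_contra hlt
    push Not at hlt
    have := (hr x).eventually (gt_mem_nhds hlt)
    have h2 : ∀ᶠ z in 𝓝[>] x, F z < p := this.filter_mono (nhdsWithin_mono _ Ioi_subset_Ici_self)
    obtain ⟨z, hz, hxz⟩ := (h2.and self_mem_nhdsWithin).exists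
    have hxz : x < z := hxz
    obtain ⟨w, hw, hwz⟩ := exists_lt_of_csInf_lt hne (lt_of_le_of_lt h hxz)
    exact absurd (le_trans hw (hm hwz.le)) (not_le.2 hz)
  · intro h
    exact csInf_le hbdd h

lemma df_nonneg {F : ℝ → ℝ} (hF : IsDF F) (x : ℝ) : 0 ≤ F x :=
  hF.1.le_of_tendsto hF.2.2.1 x

lemma df_le_one {F : ℝ → ℝ} (hF : IsDF F) (x : ℝ) : F x ≤ 1 :=
  hF.1.ge_of_tendsto hF.2.2.2 x

lemma genInv_mono {F : ℝ → ℝ} (hF : IsDF F) {p q : ℝ} (h0 : 0 < p) (hpq : p ≤ q) (h1 : q < 1) :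
    genInv F p ≤ genInv F q := by
  rw [genInv_le_iff hF h0 (lt_of_le_of_lt hpq h1)]
  exact hpq.trans ((genInv_le_iff hF (lt_of_lt_of_le h0 hpq) h1 _).1 le_rfl)

lemma df_upEnd {F : ℝ → ℝ} (hF : IsDF F) (hb : BddAbove {x | F x < 1}) {x : ℝ}
    (hx : upEnd F ≤ x) : F x = 1 := by
  apply le_antisymm (df_le_one hF x)
  have hgt : ∀ z, x < z → 1 ≤ F z := by
    intro z hz
    by_contra hlt
    push Not at hlt
    have : z ≤ upEnd F := le_csSup hb hlt
    linarith
  have h2 : Tendsto F (𝓝[>] x) (𝓝 (F x)) :=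
    (hF.2.1 x).mono_left (nhdsWithin_mono _ Ioi_subset_Ici_self)
  exact ge_of_tendsto h2 (eventually_of_mem self_mem_nhdsWithin hgt)

lemma weibull_neg {γ x : ℝ} (hx : x < 0) : weibullDF γ x = Real.exp (-((-x) ^ γ)) := by
  simp [weibullDF, hx]

lemma weibull_cont {γ x : ℝ} (hx : x ≠ 0) : ContinuousAt (weibullDF γ) x := by
  rcases lt_or_gt_of_ne hx with h | h
  · have h1 : weibullDF γ =ᶠ[𝓝 x] fun x => Real.exp (-((-x) ^ γ)) := by
      filter_upwards [gt_mem_nhds h] with y hy using weibull_neg hy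
    rw [continuousAt_congr h1]
    have : ContinuousAt (fun x : ℝ => (-x) ^ γ) x :=
      ContinuousAt.rpow_const continuousAt_neg (Or.inl (by linarith))
    exact Real.continuous_exp.continuousAt.comp this.neg
  · have h1 : weibullDF γ =ᶠ[𝓝 x] fun x => 1 := by
      filter_upwards [lt_mem_nhds h] with y hy
      simp [weibullDF, hy.le]
    rw [continuousAt_congr h1]
    exact continuousAt_const

lemma pow_exp_lim (y : ℝ) : Tendsto (fun n : ℕ => (1 - y / n) ^ n) atTop (𝓝 (Real.exp (-y))) := by
  have := Real.tendsto_one_add_div_pow_exp (-y)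
  refine this.congr fun n => ?_
  rw [neg_div, sub_eq_add_neg]

lemma small_div_nat {y : ℝ} (hy : 0 < y) : ∀ᶠ n : ℕ in atTop, 0 < y / (n : ℝ) ∧ y / (n : ℝ) < 1 := by
  have h : Tendsto (fun n : ℕ => y / (n : ℝ)) atTop (𝓝 0) := tendsto_const_div_atTop_nhds_zero_nat y
  filter_upwards [h.eventually (gt_mem_nhds one_pos), eventually_gt_atTop 0] with n h1 h2
  exact ⟨by positivity, h1⟩

/-- uniform convergence from monotonicity -/
lemma mono_unif {g : ℕ → ℝ → ℝ} {G : ℝ → ℝ}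
    (hm : ∀ᶠ k in atTop, MonotoneOn (g k) (Ioo 0 2))
    (hl : ∀ y ∈ Ioo (0 : ℝ) 2, Tendsto (fun k => g k y) atTop (𝓝 (G y)))
    (hc : ∀ y ∈ Ioo (0 : ℝ) 2, ContinuousAt G y) :
    TendstoUniformlyOn g G atTop (Icc (1 / 2) 1) := by
  rw [← tendstoLocallyUniformlyOn_iff_tendstoUniformlyOn_of_compact isCompact_Icc,
    Metric.tendstoLocallyUniformlyOn_iff]
  intro ε hε y hy
  have hy' : y ∈ Ioo (0 : ℝ) 2 := ⟨by linarith [hy.1], by linarith [hy.2]⟩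
  have h1 : ∀ᶠ z in 𝓝 y, z ∈ Ioo (0 : ℝ) 2 ∧ dist (G z) (G y) < ε / 4 :=
    Filter.Eventually.and (isOpen_Ioo.mem_nhds hy')
      ((hc y hy').eventually (Metric.ball_mem_nhds _ (by positivity)))
  obtain ⟨δ, hδ, hball⟩ := Metric.eventually_nhds_iff.1 h1
  have e : ∀ z, |z - y| ≤ δ / 2 → z ∈ Ioo (0 : ℝ) 2 ∧ |G z - G y| < ε / 4 := by
    intro z hz
    exact hball (by rw [Real.dist_eq]; linarith)
  have e1 := e (y - δ / 2) (by rw [abs_le]; constructor <;> linarith)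
  have e2 := e (y + δ / 2) (by rw [abs_le]; constructor <;> linarith)
  refine ⟨Icc (y - δ / 2) (y + δ / 2),
    mem_nhdsWithin_of_mem_nhds (Icc_mem_nhds (by linarith) (by linarith)), ?_⟩
  filter_upwards [hm, (hl _ e1.1).eventually (Metric.ball_mem_nhds _ (show 0 < ε / 4 by positivity)),
    (hl _ e2.1).eventually (Metric.ball_mem_nhds _ (show 0 < ε / 4 by positivity))] with k hk h3 h4 z hz
  have ez := e z (by rw [abs_le]; constructor <;> linarith [hz.1, hz.2])
  have m1 := hk e1.1 ez.1 hz.1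
  have m2 := hk ez.1 e2.1 hz.2
  rw [Real.dist_eq] at h3 h4
  rw [Real.dist_eq]
  have q1 := e1.2
  have q2 := e2.2
  have q3 := ez.2
  rw [abs_lt] at *
  constructor <;> linarith [q1.1, q1.2, q2.1, q2.2, q3.1, q3.2, h3.1, h3.2, h4.1, h4.2]

lemma int_small {b : ℝ → ℝ} (hb : Tendsto b (𝓝[>] (0 : ℝ)) (𝓝 0)) {y : ℝ} (hy : 0 < y) :
    Tendsto (fun n : ℕ => ∫ t in (y / (n : ℝ))..(1 / (n : ℝ)), b t / t) atTop (𝓝 0) := by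
  set m := min y 1 with hm
  have hmpos : 0 < m := lt_min hy one_pos
  rw [Metric.tendsto_atTop']
  intro ε hε
  set η := ε * m / (2 * (|1 - y| + 1)) with hη
  have hηpos : 0 < η := by positivity
  have h1 : ∀ᶠ t in 𝓝[>] (0 : ℝ), |b t| < η := by
    have := hb.eventually (Metric.ball_mem_nhds 0 hηpos)
    simpa [Real.dist_eq] using this
  rw [eventually_nhdsWithin_iff, Metric.eventually_nhds_iff] at h1
  obtain ⟨δ, hδ, h1⟩ := h1
  have h2 : Tendsto (fun n : ℕ => (y + 1) / (n : ℝ)) atTop (𝓝 0) := tendsto_const_div_atTop_nhds_zero_nat _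
  have h3 := (h2.eventually (gt_mem_nhds hδ)).and (eventually_gt_atTop 0)
  obtain ⟨N, hN⟩ := eventually_atTop.1 h3
  refine ⟨N, fun n hn => ?_⟩
  obtain ⟨hn1, hn0⟩ := hN n hn.le
  have hnpos : (0 : ℝ) < n := by exact_mod_cast hn0
  rw [Real.dist_eq, sub_zero]
  have key : ∀ t ∈ Set.uIoc (y / (n : ℝ)) (1 / (n : ℝ)), ‖b t / t‖ ≤ η / (m / n) := by
    intro t ht
    have hlo : m / n < t := by
      have := ht.1
      rw [← min_div_div_right hnpos.le] at *
      exact this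
    have htpos : 0 < t := lt_trans (by positivity) hlo
    have hhi : t < δ := by
      have h5 : t ≤ max (y / (n:ℝ)) (1 / n) := ht.2
      have h6 : max (y / (n:ℝ)) (1 / n) ≤ (y + 1) / n := by
        apply max_le <;> gcongr <;> linarith
      linarith
    have h7 := h1 (by rw [Real.dist_eq, sub_zero, abs_of_pos htpos]; exact hhi) htpos
    rw [Real.norm_eq_abs, abs_div, abs_of_pos htpos]
    gcongr
  have h8 := intervalIntegral.norm_integral_le_of_norm_le_const key
  rw [Real.norm_eq_abs] at h8
  refine lt_of_le_of_lt h8 ?_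
  have h9 : |1 / (n:ℝ) - y / n| = |1 - y| / n := by
    rw [← sub_div, abs_div, abs_of_pos hnpos]
  rw [h9]
  have h10 : η / (m / n) * (|1 - y| / n) = ε * (|1 - y| / (2 * (|1 - y| + 1))) := by
    rw [hη]; field_simp
  rw [h10]
  have h11 : |1 - y| / (2 * (|1 - y| + 1)) < 1 := by
    rw [div_lt_one (by positivity)]
    linarith [abs_nonneg (1 - y)]
  nlinarith

lemma rep_rv {V f b : ℝ → ℝ} {c d : ℝ} (hc : 0 < c)
    (hf : Tendsto f (𝓝[>] (0 : ℝ)) (𝓝 0)) (hb : Tendsto b (𝓝[>] (0 : ℝ)) (𝓝 0))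
    (hint : ∀ u ∈ Set.Ioo (0 : ℝ) 1, IntegrableOn (fun t => b t / t) (Set.Ioc u 1))
    (hV : ∀ u ∈ Set.Ioo (0 : ℝ) 1, V u = c * (1 + f u) * u ^ d * Real.exp (∫ t in u..1, b t / t)) :
    (∀ᶠ n : ℕ in atTop, 0 < V (1 / n)) ∧
    ∀ y, 0 < y → Tendsto (fun n : ℕ => V (y / n) / V (1 / n)) atTop (𝓝 (y ^ d)) := by
  have hlim : ∀ y : ℝ, 0 < y → Tendsto (fun n : ℕ => y / (n : ℝ)) atTop (𝓝[>] 0) := by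
    intro y hy
    rw [tendsto_nhdsWithin_iff]
    exact ⟨tendsto_const_div_atTop_nhds_zero_nat y, (small_div_nat hy).mono fun n h => h.1⟩
  have hfy : ∀ y : ℝ, 0 < y → Tendsto (fun n : ℕ => 1 + f (y / n)) atTop (𝓝 1) := by
    intro y hy
    simpa using (hf.comp (hlim y hy)).const_add 1
  constructor
  · filter_upwards [small_div_nat one_pos, (hfy 1 one_pos).eventually (lt_mem_nhds one_pos)] with n h1 h2
    rw [hV _ h1]
    have := h1.1
    positivity
  · intro y hy
    have hL : Tendsto (fun n : ℕ => (1 + f (y / n)) / (1 + f (1 / n)) * y ^ d *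
        Real.exp (∫ t in (y / (n : ℝ))..(1 / (n : ℝ)), b t / t)) atTop (𝓝 (1 / 1 * y ^ d * Real.exp 0)) :=
      (((hfy y hy).div (hfy 1 one_pos) one_ne_zero).mul_const _).mul
        ((Real.continuous_exp.tendsto 0).comp (int_small hb hy))
    simp only [div_one, one_mul, Real.exp_zero, mul_one] at hL
    refine hL.congr' ?_
    filter_upwards [small_div_nat one_pos, small_div_nat hy, eventually_gt_atTop 0,
      (hfy 1 one_pos).eventually (lt_mem_nhds one_pos)] with n h1 h2 h3 h4
    have hnpos : (0 : ℝ) < n := by exact_mod_cast h3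
    rw [hV _ h1, hV _ h2]
    have i1 : ∀ u ∈ Ioo (0:ℝ) 1, IntervalIntegrable (fun t => b t / t) volume u 1 := by
      intro u hu
      rw [intervalIntegrable_iff_integrableOn_Ioc_of_le hu.2.le]
      exact hint u hu
    have i3 : (∫ t in (y / (n : ℝ))..1, b t / t) =
        (∫ t in (y / (n : ℝ))..(1 / (n : ℝ)), b t / t) + ∫ t in (1 / (n : ℝ))..1, b t / t :=
      (intervalIntegral.integral_add_adjacent_intervals
        ((i1 _ h2).trans (i1 _ h1).symm) (i1 _ h1)).symm
    rw [i3, Real.exp_add]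
    have i4 : (y / (n:ℝ)) ^ d = y ^ d * (1 / (n:ℝ)) ^ d := by
      rw [← Real.mul_rpow hy.le (by positivity)]; congr 1; ring
    rw [i4]
    have i5 : 0 < (1 / (n:ℝ)) ^ d := by positivity
    have := Real.exp_pos (∫ t in (1 / (n : ℝ))..1, b t / t)
    field_simp

lemma converse_dir {F : ℝ → ℝ} (hF : IsDF F) {γ : ℝ} (hγ : 0 < γ)
    (hbdd : BddAbove {x | F x < 1}) {V : ℝ → ℝ}
    (hV : ∀ u ∈ Ioo (0:ℝ) 1, V u = upEnd F - genInv F (1 - u))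
    (hpos : ∀ᶠ n : ℕ in atTop, 0 < V (1 / n))
    (hlim : ∀ y, 0 < y → Tendsto (fun n : ℕ => V (y / n) / V (1 / n)) atTop (𝓝 (y ^ (1 / γ)))) :
    MemDomAttr F (weibullDF γ) := by
  classical
  refine ⟨fun n => if 0 < V (1 / n) then V (1 / n) else 1, fun _ => upEnd F, fun n => ?_, ?_⟩
  · dsimp only
    split_ifs with h
    · exact h
    · exact one_pos
  intro x _
  rcases le_or_gt 0 x with hx | hx
  · have : weibullDF γ x = 1 := by simp [weibullDF, hx]
    rw [this]
    refine tendsto_const_nhds.congr' ?_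
    filter_upwards [hpos] with n hn
    rw [if_pos hn, df_upEnd hF hbdd (by nlinarith), one_pow]
  · rw [weibull_neg hx]
    set s := (-x) ^ γ with hs
    have hs0 : 0 < s := Real.rpow_pos_of_pos (by linarith) _
    have hsx : s ^ (1 / γ) = -x := by
      rw [hs, ← Real.rpow_mul (by linarith), mul_one_div_cancel hγ.ne', Real.rpow_one]
    have hgi : 0 < 1 / γ := by positivity
    have hup : ∀ y, 0 < y → y < s → ∀ᶠ n : ℕ in atTop,
        F ((if 0 < V (1 / n) then V (1 / n) else 1) * x + upEnd F) ^ n ≤ (1 - y / n) ^ n := by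
      intro y hy hys
      have h1 : y ^ (1 / γ) < -x := hsx ▸ Real.rpow_lt_rpow hy.le hys hgi
      filter_upwards [hpos, (hlim y hy).eventually (gt_mem_nhds h1), small_div_nat hy] with n hn h2 h3
      rw [if_pos hn]
      rw [div_lt_iff₀ hn, hV _ h3] at h2
      have h4 : ¬ (genInv F (1 - y / n) ≤ V (1 / n) * x + upEnd F) := by
        push Not; linarith
      rw [genInv_le_iff hF (by linarith [h3.2]) (by linarith [h3.1])] at h4
      push Not at h4
      exact pow_le_pow_left₀ (df_nonneg hF _) h4.le n
    have hlo : ∀ y, s < y → ∀ᶠ n : ℕ in atTop, (1 - y / n) ^ n ≤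
        F ((if 0 < V (1 / n) then V (1 / n) else 1) * x + upEnd F) ^ n := by
      intro y hys
      have hy : 0 < y := hs0.trans hys
      have h1 : -x < y ^ (1 / γ) := hsx ▸ Real.rpow_lt_rpow hs0.le hys hgi
      filter_upwards [hpos, (hlim y hy).eventually (lt_mem_nhds h1), small_div_nat hy] with n hn h2 h3
      rw [if_pos hn]
      rw [lt_div_iff₀ hn, hV _ h3] at h2
      have h4 : (genInv F (1 - y / n) ≤ V (1 / n) * x + upEnd F) := by linarith
      rw [genInv_le_iff hF (by linarith [h3.2]) (by linarith [h3.1])] at h4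
      exact pow_le_pow_left₀ (by linarith [h3.2]) h4 n
    have hcont : ContinuousAt (fun y : ℝ => Real.exp (-y)) s := by fun_prop
    rw [tendsto_order]
    constructor
    · intro r hr
      have h1 : ∀ᶠ y in 𝓝[>] s, r < Real.exp (-y) :=
        (hcont.eventually (lt_mem_nhds hr)).filter_mono nhdsWithin_le_nhds
      obtain ⟨y, hy, hys⟩ := (h1.and self_mem_nhdsWithin).exists
      filter_upwards [hlo y hys, (pow_exp_lim y).eventually (lt_mem_nhds hy)] with n a1 a2
      exact lt_of_lt_of_le a2 a1
    · intro r hr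
      have h1 : ∀ᶠ y in 𝓝[<] s, Real.exp (-y) < r :=
        (hcont.eventually (gt_mem_nhds hr)).filter_mono nhdsWithin_le_nhds
      have h2 : ∀ᶠ y in 𝓝[<] s, 0 < y := (lt_mem_nhds hs0).filter_mono nhdsWithin_le_nhds
      obtain ⟨y, ⟨hy, hy0⟩, hys⟩ := ((h1.and h2).and self_mem_nhdsWithin).exists
      filter_upwards [hup y hy0 hys, (pow_exp_lim y).eventually (gt_mem_nhds hy)] with n a1 a2
      exact lt_of_le_of_lt a1 a2

lemma quant_lim {F : ℝ → ℝ} (hF : IsDF F) {γ : ℝ} (hγ : 0 < γ) {a b : ℕ → ℝ}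
    (ha : ∀ n, 0 < a n)
    (h : ∀ x, ContinuousAt (weibullDF γ) x →
      Tendsto (fun n => F (a n * x + b n) ^ n) atTop (𝓝 (weibullDF γ x))) {y : ℝ} (hy : 0 < y) :
    Tendsto (fun n : ℕ => (genInv F (1 - y / n) - b n) / a n) atTop (𝓝 (-(y ^ (1 / γ)))) := by
  have hp : 0 < y ^ (1 / γ) := by positivity
  have hyy : (y ^ (1 / γ)) ^ γ = y := by
    rw [← Real.rpow_mul hy.le, one_div_mul_cancel hγ.ne', Real.rpow_one]
  have hlow : ∀ r, r < -(y ^ (1 / γ)) → ∀ᶠ n : ℕ in atTop,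
      r < (genInv F (1 - y / n) - b n) / a n := by
    intro r hr
    have hr0 : r < 0 := by linarith
    have h1 := h r (weibull_cont hr0.ne)
    rw [weibull_neg hr0] at h1
    have h2 : y < (-r) ^ γ := by
      calc y = (y ^ (1 / γ)) ^ γ := hyy.symm
        _ < _ := Real.rpow_lt_rpow hp.le (by linarith) hγ
    have h3 : Real.exp (-((-r) ^ γ)) < Real.exp (-y) := Real.exp_lt_exp.2 (by linarith)
    filter_upwards [h1.eventually_lt (pow_exp_lim y) h3, small_div_nat hy] with n h4 h5
    have h6 := lt_of_pow_lt_pow_left₀ n (by linarith [h5.2]) h4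
    rw [← not_le, ← genInv_le_iff hF (by linarith [h5.2]) (by linarith [h5.1])] at h6
    rw [lt_div_iff₀ (ha n)]
    push Not at h6
    linarith
  have hupp : ∀ r, -(y ^ (1 / γ)) < r → r < 0 → ∀ᶠ n : ℕ in atTop,
      (genInv F (1 - y / n) - b n) / a n ≤ r := by
    intro r hr hr0
    have h1 := h r (weibull_cont hr0.ne)
    rw [weibull_neg hr0] at h1
    have h2 : (-r) ^ γ < y := by
      calc (-r) ^ γ < (y ^ (1 / γ)) ^ γ := Real.rpow_lt_rpow (by linarith) (by linarith) hγ
        _ = y := hyy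
    have h3 : Real.exp (-y) < Real.exp (-((-r) ^ γ)) := Real.exp_lt_exp.2 (by linarith)
    filter_upwards [(pow_exp_lim y).eventually_lt h1 h3, small_div_nat hy] with n h4 h5
    have h6 := lt_of_pow_lt_pow_left₀ n (df_nonneg hF _) h4
    have h7 := (genInv_le_iff hF (by linarith [h5.2]) (by linarith [h5.1]) _).2 h6.le
    rw [div_le_iff₀ (ha n)]
    linarith
  rw [tendsto_order]
  refine ⟨hlow, fun r hr => ?_⟩
  obtain ⟨r', h1, h2⟩ := exists_between (lt_min hr (show -(y ^ (1 / γ)) < 0 by linarith))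
  filter_upwards [hupp r' h1 (lt_of_lt_of_le h2 (min_le_right _ _))] with n hn
  exact lt_of_le_of_lt hn (lt_of_lt_of_le h2 (min_le_left _ _))

lemma types_lemma {F : ℝ → ℝ} (hF : IsDF F) {γ : ℝ} (hγ : 0 < γ)
    (h : MemDomAttr F (weibullDF γ)) :
    BddAbove {x | F x < 1} ∧ ∃ A : ℕ → ℝ, (∀ k, 0 < A k) ∧
      Tendsto (fun k => A (k + 1) / A k) atTop (𝓝 ((1 / 2) ^ (1 / γ))) ∧
      ∀ y, 0 < y → Tendsto (fun k : ℕ => (upEnd F - genInv F (1 - y / 2 ^ k)) / A k) atTop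
        (𝓝 (y ^ (1 / γ))) := by
  obtain ⟨a, b, ha, h⟩ := h
  set A : ℕ → ℝ := fun k => a (2 ^ k) with hA
  set B : ℕ → ℝ := fun k => b (2 ^ k) with hB
  have hApos : ∀ k, 0 < A k := fun k => ha _
  have hpow : Tendsto (fun k : ℕ => 2 ^ k) atTop (atTop : Filter ℕ) :=
    tendsto_pow_atTop_atTop_of_one_lt (by norm_num)
  have hq : ∀ y, 0 < y → Tendsto (fun k : ℕ => (genInv F (1 - y / 2 ^ k) - B k) / A k) atTop
      (𝓝 (-(y ^ (1 / γ)))) := by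
    intro y hy
    refine ((quant_lim hF hγ ha h hy).comp hpow).congr fun k => ?_
    simp [hA, hB]
  have hq' : ∀ y, 0 < y → Tendsto (fun k : ℕ => (genInv F (1 - y / 2 ^ k) - B (k + 1)) / A (k + 1))
      atTop (𝓝 (-((2 * y) ^ (1 / γ)))) := by
    intro y hy
    refine ((hq (2 * y) (by positivity)).comp (tendsto_add_atTop_nat 1)).congr fun k => ?_
    have : 2 * y / 2 ^ (k + 1) = y / 2 ^ k := by rw [pow_succ]; field_simp
    simp only [Function.comp]
    rw [this]
  have hgi : 0 < 1 / γ := by positivity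
  set σ : ℝ := 2 ^ (1 / γ) with hσ
  have hσ1 : 1 < σ := Real.one_lt_rpow (by norm_num) hgi
  have hρ : ((1:ℝ) / 2) ^ (1 / γ) = σ⁻¹ := by
    rw [one_div (2:ℝ), Real.inv_rpow (by norm_num)]
  have h1 := hq 1 one_pos
  have h2 := hq 2 two_pos
  have h1' := hq' 1 one_pos
  have h2' := hq' 2 two_pos
  rw [Real.one_rpow] at h1
  rw [mul_one] at h1'
  rw [Real.mul_rpow (by norm_num) (by norm_num)] at h2'
  have hd := h1.sub h2
  have hd' := h1'.sub h2'
  have hne : -σ - -(σ * σ) ≠ 0 := by nlinarith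
  have hAr : Tendsto (fun k => A (k + 1) / A k) atTop (𝓝 σ⁻¹) := by
    have h3 := hd.div hd' hne
    have h4 : (-1 - -σ) / (-σ - -(σ * σ)) = σ⁻¹ := by
      have : σ - 1 ≠ 0 := by linarith
      rw [show -σ - -(σ * σ) = σ * (σ - 1) by ring]
      field_simp
      ring
    rw [h4] at h3
    refine h3.congr' ?_
    filter_upwards [hd'.eventually_ne hne] with k hk
    have e1 := (hApos k).ne'
    have e2 := (hApos (k + 1)).ne'
    simp only [Pi.div_apply, ← sub_div] at hk ⊢
    have e3 : genInv F (1 - 1 / 2 ^ k) - B (k + 1) - (genInv F (1 - 2 / 2 ^ k) - B (k + 1)) ≠ 0 := by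
      intro h0; rw [h0, zero_div] at hk; exact hk rfl
    simp only [sub_sub_sub_cancel_right] at e3 ⊢
    generalize genInv F (1 - 1 / 2 ^ k) - genInv F (1 - 2 / 2 ^ k) = w at e3 ⊢
    field_simp
  have hBr : Tendsto (fun k => (B (k + 1) - B k) / A k) atTop (𝓝 0) := by
    have h3 := h1.sub (h1'.mul hAr)
    have h4 : -1 - -σ * σ⁻¹ = 0 := by field_simp; ring
    rw [h4] at h3
    refine h3.congr fun k => ?_
    have e1 := (hApos k).ne'
    have e2 := (hApos (k + 1)).ne'
    field_simp
    ring
  have hB0 : ∀ C, 0 < C → ∃ K, ∀ k ≥ K, ∀ m ≥ k,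
      B m + C * A m ≤ B k + C * A k ∧ B k - C * A k ≤ B m - C * A m := by
    intro C hC
    have hσi : σ⁻¹ < 1 := inv_lt_one_of_one_lt₀ hσ1
    obtain ⟨r, hr1, hr2⟩ := exists_between hσi
    have e1 := hAr.eventually (gt_mem_nhds hr1)
    have e2 : ∀ᶠ k in atTop, |(B (k + 1) - B k) / A k| < C * (1 - r) := by
      have : 0 < C * (1 - r) := mul_pos hC (by linarith)
      have := hBr.eventually (Metric.ball_mem_nhds 0 this)
      simpa [Real.dist_eq, abs_div] using this
    obtain ⟨K, hK⟩ := eventually_atTop.1 (e1.and e2)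
    refine ⟨K, fun k hk m hm => ?_⟩
    induction m, hm using Nat.le_induction with
    | base => exact ⟨le_rfl, le_rfl⟩
    | succ m hm ih =>
      obtain ⟨f1, f2⟩ := hK m (le_trans hk hm)
      rw [div_lt_iff₀ (hApos m)] at f1
      rw [abs_div, abs_of_pos (hApos m), div_lt_iff₀ (hApos m), abs_lt] at f2
      obtain ⟨f2, f3⟩ := f2
      have f4 := mul_le_mul_of_nonneg_left f1.le hC.le
      constructor
      · refine le_trans ?_ ih.1; nlinarith
      · refine le_trans ih.2 ?_; nlinarith
  have hone : ∀ C, 0 < C → Tendsto (fun m => F (A m * C + B m) ^ (2 ^ m)) atTop (𝓝 1) := by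
    intro C hC
    have := (h C (weibull_cont hC.ne')).comp hpow
    simpa [weibullDF, hC.le, not_lt.2 hC.le, hA, hB, Function.comp_def] using this
  have hless : ∀ C, 0 < C → ∀ᶠ m in atTop, F (B m - C * A m) < 1 := by
    intro C hC
    have h3 := (h (-C) (weibull_cont (by linarith))).comp hpow
    rw [weibull_neg (by linarith)] at h3
    have h4 : Real.exp (-((- -C) ^ γ)) < 1 := by
      rw [Real.exp_lt_one_iff, neg_neg, neg_lt_zero]; positivity
    filter_upwards [h3.eventually (gt_mem_nhds h4)] with m hm
    by_contra hge
    push Not at hge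
    have h5 : 1 ≤ F (B m - C * A m) ^ (2 ^ m) := one_le_pow₀ hge
    have h6 : B m - C * A m = a (2 ^ m) * -C + b (2 ^ m) := by simp only [hA, hB]; ring
    rw [h6] at h5
    simp only [Function.comp] at hm
    linarith
  have hup : ∀ C, 0 < C → ∃ K, ∀ k ≥ K, 1 ≤ F (B k + C * A k) := by
    intro C hC
    obtain ⟨K, hK⟩ := hB0 C hC
    refine ⟨K, fun k hk => ?_⟩
    refine le_of_tendsto (hone C hC) ?_
    filter_upwards [eventually_ge_atTop k] with m hm
    have h3 := (hK k hk m hm).1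
    have h4 : F (A m * C + B m) ≤ F (B k + C * A k) := hF.1 (by linarith)
    exact le_trans (pow_le_of_le_one (df_nonneg hF _) (df_le_one hF _) (by positivity)) h4
  have hbd : ∀ x, 1 ≤ F x → ∀ z ∈ {x | F x < 1}, z ≤ x := by
    intro x hx z hz
    by_contra hlt
    push Not at hlt
    have h3 := hF.1 hlt.le
    have h4 : F z < 1 := hz
    linarith
  have hbdd : BddAbove {x | F x < 1} := by
    obtain ⟨K, hK⟩ := hup 1 one_pos
    exact ⟨_, hbd _ (hK K le_rfl)⟩
  have hneE : {x | F x < 1}.Nonempty := by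
    obtain ⟨y, hy⟩ := (hF.2.2.1.eventually (gt_mem_nhds one_pos)).exists
    exact ⟨y, hy⟩
  have hend : Tendsto (fun k => (upEnd F - B k) / A k) atTop (𝓝 0) := by
    rw [Metric.tendsto_atTop]
    intro ε hε
    obtain ⟨K1, hK1⟩ := hup (ε / 2) (by positivity)
    obtain ⟨K2, hK2⟩ := hB0 (ε / 2) (by positivity)
    refine ⟨max K1 K2, fun k hk => ?_⟩
    have g1 : upEnd F ≤ B k + ε / 2 * A k :=
      csSup_le hneE (hbd _ (hK1 k (le_trans (le_max_left _ _) hk)))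
    obtain ⟨m, hm1, hm2⟩ := ((hless (ε / 2) (by positivity)).and (eventually_ge_atTop k)).exists
    have g2 : B m - ε / 2 * A m ≤ upEnd F := le_csSup hbdd hm1
    have g3 := (hK2 k (le_trans (le_max_right _ _) hk) m hm2).2
    have := hApos k
    rw [Real.dist_eq, sub_zero, abs_div, abs_of_pos this, div_lt_iff₀ this, abs_lt]
    constructor <;> nlinarith
  refine ⟨hbdd, A, hApos, ?_, ?_⟩
  · rw [hρ]; exact hAr
  · intro y hy
    have h3 := hend.sub (hq y hy)
    simp only [zero_sub, neg_neg] at h3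
    refine h3.congr fun k => ?_
    rw [← sub_div]; congr 1; ring

def kap (u : ℝ) : ℕ := ⌊-(Real.logb 2 u)⌋₊

lemma kap_spec {u : ℝ} (h0 : 0 < u) (h1 : u ≤ 1) : 1 / 2 < u * 2 ^ kap u ∧ u * 2 ^ kap u ≤ 1 := by
  have hl : Real.logb 2 u ≤ 0 := by
    exact Real.logb_nonpos (by norm_num) h0.le h1
  have e : u = (2:ℝ) ^ (Real.logb 2 u) := (Real.rpow_logb (by norm_num) (by norm_num) h0).symm
  have f1 : (kap u : ℝ) ≤ -(Real.logb 2 u) := Nat.floor_le (by linarith)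
  have f2 : -(Real.logb 2 u) < kap u + 1 := Nat.lt_floor_add_one _
  have e2 : u * 2 ^ kap u = (2:ℝ) ^ (Real.logb 2 u + kap u) := by
    rw [Real.rpow_add (by norm_num), ← e, Real.rpow_natCast]
  rw [e2]
  constructor
  · have : (1:ℝ) / 2 = 2 ^ (-1 : ℝ) := by rw [Real.rpow_neg_one]; norm_num
    rw [this]
    exact Real.rpow_lt_rpow_of_exponent_lt (by norm_num) (by linarith)
  · exact Real.rpow_le_one_of_one_le_of_nonpos (by norm_num) (by linarith)

lemma kap_unique {u : ℝ} {k : ℕ} (h1 : 1 / 2 < u * 2 ^ k) (h2 : u * 2 ^ k ≤ 1) : kap u = k := by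
  have hp : (0:ℝ) < 2 ^ k := by positivity
  have h0 : 0 < u := by
    by_contra hn
    push Not at hn
    nlinarith
  have hl : Real.logb 2 (u * 2 ^ k) = Real.logb 2 u + k := by
    rw [Real.logb_mul h0.ne' hp.ne', Real.logb_pow, Real.logb_self_eq_one (by norm_num), mul_one]
  have g1 : Real.logb 2 (u * 2 ^ k) ≤ 0 := by
    exact Real.logb_nonpos (by norm_num) (by positivity) h2
  have g2 : -1 < Real.logb 2 (u * 2 ^ k) := by
    have : Real.logb 2 (1 / 2) = -1 := by
      rw [one_div, Real.logb_inv, Real.logb_self_eq_one (by norm_num)]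
    rw [← this]
    exact Real.logb_lt_logb (by norm_num) (by norm_num) h1
  rw [kap, Nat.floor_eq_iff (by linarith [Nat.cast_nonneg (α := ℝ) k])]
  constructor <;> linarith

lemma kap_meas : Measurable kap := by
  unfold kap
  refine Nat.measurable_floor.comp ?_
  unfold Real.logb
  fun_prop

lemma kap_tendsto : Tendsto kap (𝓝[>] (0:ℝ)) atTop := by
  unfold kap
  refine tendsto_nat_floor_atTop.comp ?_
  exact tendsto_neg_atBot_atTop.comp (Real.tendsto_logb_nhdsGT_zero (by norm_num))

section rep
variable {A : ℕ → ℝ} {d : ℝ} {β : ℕ → ℝ}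

lemma rep_integrable {M : ℝ} (hM : ∀ k, |β k| ≤ M) {u : ℝ} (hu : 0 < u) :
    IntegrableOn (fun t => β (kap t) / t) (Ioc u 1) := by
  have hmeas : Measurable (fun t : ℝ => β (kap t) / t) :=
    (measurable_from_nat.comp kap_meas).div measurable_id
  refine Measure.integrableOn_of_bounded (M := M / u) (by simp) hmeas.aestronglyMeasurable ?_
  filter_upwards [ae_restrict_mem measurableSet_Ioc] with t ht
  have h0 : 0 < t := hu.trans ht.1
  have hM0 : 0 ≤ M := (abs_nonneg _).trans (hM 0)
  rw [Real.norm_eq_abs, abs_div, abs_of_pos h0]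
  exact div_le_div₀ hM0 (hM _) hu ht.1.le

lemma rep_piece {u v : ℝ} {k : ℕ} (h1 : 1 / 2 ≤ u * 2 ^ k) (huv : u ≤ v) (h2 : v * 2 ^ k ≤ 1) :
    ∫ t in u..v, β (kap t) / t = β k * (Real.log v - Real.log u) := by
  have hp : (0:ℝ) < 2 ^ k := by positivity
  have h0 : 0 < u := by
    by_contra hn
    push Not at hn
    nlinarith
  have : ∫ t in u..v, β (kap t) / t = ∫ t in u..v, β k * (1 / t) := by
    apply intervalIntegral.integral_congr_ae
    refine Eventually.of_forall fun t ht => ?_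
    rw [uIoc_of_le huv] at ht
    rw [kap_unique (k := k) (by nlinarith [ht.1]) (by nlinarith [ht.2])]
    ring
  rw [this, intervalIntegral.integral_const_mul, integral_one_div_of_pos h0 (by linarith),
    Real.log_div (by linarith) h0.ne']

lemma rep_dyadic {M : ℝ} (hM : ∀ k, |β k| ≤ M)
    (hβ : ∀ k, β k * Real.log 2 = d * Real.log 2 + Real.log (A (k + 1)) - Real.log (A k)) (k : ℕ) :
    ∫ t in (1 / 2 ^ k : ℝ)..1, β (kap t) / t = d * k * Real.log 2 + Real.log (A k) - Real.log (A 0) := by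
  have hi : ∀ k : ℕ, IntervalIntegrable (fun t => β (kap t) / t) volume (1 / 2 ^ k : ℝ) 1 := by
    intro k
    have : (1 / 2 ^ k : ℝ) ≤ 1 := by
      rw [div_le_one (by positivity)]; exact one_le_pow₀ (by norm_num)
    rw [intervalIntegrable_iff_integrableOn_Ioc_of_le this]
    exact rep_integrable hM (by positivity)
  induction k with
  | zero => simp
  | succ k ih =>
    rw [← intervalIntegral.integral_add_adjacent_intervals ((hi (k + 1)).trans (hi k).symm) (hi k), ih,
      rep_piece (k := k) (by rw [pow_succ]; field_simp; rfl)
        (one_div_le_one_div_of_le (by positivity) (pow_le_pow_right₀ (by norm_num) (Nat.le_succ k)))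
        (by field_simp; rfl)]
    rw [one_div, one_div, Real.log_inv, Real.log_inv, Real.log_pow, Real.log_pow]
    push_cast
    have := hβ k
    linarith

lemma rep_formula (hA : ∀ k, 0 < A k) {M : ℝ} (hM : ∀ k, |β k| ≤ M)
    (hβ : ∀ k, β k * Real.log 2 = d * Real.log 2 + Real.log (A (k + 1)) - Real.log (A k))
    {u : ℝ} (h0 : 0 < u) (h1 : u ≤ 1) :
    A 0 * u ^ d * Real.exp (∫ t in u..1, β (kap t) / t) =
      A (kap u) * (u * 2 ^ kap u) ^ (d - β (kap u)) := by
  obtain ⟨s1, s2⟩ := kap_spec h0 h1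
  set k := kap u with hk
  have hp : (0:ℝ) < 2 ^ k := by positivity
  have huk : u ≤ 1 / 2 ^ k := by rw [le_div_iff₀ hp]; exact s2
  have hk1 : (1 / 2 ^ k : ℝ) ≤ 1 := by
    rw [div_le_one (by positivity)]; exact one_le_pow₀ (by norm_num)
  have hi : ∀ w : ℝ, 0 < w → w ≤ 1 → IntervalIntegrable (fun t => β (kap t) / t) volume w 1 := by
    intro w hw hw1
    rw [intervalIntegrable_iff_integrableOn_Ioc_of_le hw1]
    exact rep_integrable hM hw
  have i1 := hi u h0 h1
  have i2 := hi (1 / 2 ^ k) (by positivity) hk1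
  rw [← intervalIntegral.integral_add_adjacent_intervals (i1.trans i2.symm) i2,
    rep_dyadic hM hβ, rep_piece (k := k) s1.le huk (by field_simp; rfl)]
  rw [one_div, Real.log_inv, Real.log_pow]
  have e1 : A 0 = Real.exp (Real.log (A 0)) := (Real.exp_log (hA 0)).symm
  have e2 : A k = Real.exp (Real.log (A k)) := (Real.exp_log (hA k)).symm
  rw [Real.rpow_def_of_pos h0, Real.rpow_def_of_pos (by positivity), Real.log_mul h0.ne' hp.ne',
    Real.log_pow]
  nth_rewrite 1 [e1]
  nth_rewrite 2 [e2]
  rw [← Real.exp_add, ← Real.exp_add, ← Real.exp_add]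
  congr 1
  ring

end rep

lemma quot_meas {F : ℝ → ℝ} (hF : IsDF F) {D : ℝ → ℝ} (hD : Measurable D) (x₀ : ℝ) :
    Measurable (fun u => (Ioo (0:ℝ) 1).indicator (fun u => (x₀ - genInv F (1 - u)) / D u - 1) u) := by
  have hq : Measurable (fun u => (Ioo (0:ℝ) 1).indicator (fun u => genInv F (1 - u)) u) := by
    refine measurable_of_Iic fun x => ?_
    have : (fun u => (Ioo (0:ℝ) 1).indicator (fun u => genInv F (1 - u)) u) ⁻¹' Iic x =
        (Ioo (0:ℝ) 1 ∩ Ici (1 - F x)) ∪ ((Ioo (0:ℝ) 1)ᶜ ∩ {_u | (0:ℝ) ≤ x}) := by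
      ext u
      by_cases hu : u ∈ Ioo (0:ℝ) 1
      · have := genInv_le_iff hF (p := 1 - u) (by linarith [hu.2]) (by linarith [hu.1]) x
        simp only [mem_preimage, indicator_of_mem hu, mem_Iic, this, mem_union, mem_inter_iff, hu,
          mem_Ici, true_and, mem_compl_iff, not_true, false_and, or_false]
        constructor <;> intro <;> linarith
      · simp only [mem_preimage, indicator_of_notMem hu, mem_Iic, mem_union, mem_inter_iff, hu,
          false_and, mem_compl_iff, not_false_eq_true, true_and, false_or, mem_ofPred_eq]
    rw [this]
    exact (measurableSet_Ioo.inter measurableSet_Ici).union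
      (measurableSet_Ioo.compl.inter (MeasurableSet.const _))
  have h2 : Measurable (fun u => (Ioo (0:ℝ) 1).indicator (fun u =>
      (x₀ - (Ioo (0:ℝ) 1).indicator (fun u => genInv F (1 - u)) u) / D u - 1) u) :=
    (((measurable_const.sub hq).div hD).sub_const 1).indicator measurableSet_Ioo
  convert h2 using 2 with u
  by_cases hu : u ∈ Ioo (0:ℝ) 1
  · simp [indicator_of_mem hu]
  · simp [indicator_of_notMem hu]

lemma forward_dir {F : ℝ → ℝ} (hF : IsDF F) {γ : ℝ} (hγ : 0 < γ)
    (h : MemDomAttr F (weibullDF γ)) :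
      (BddAbove {x | F x < 1} ∧
        ∃ c : ℝ, 0 < c ∧ ∃ f b : ℝ → ℝ, Measurable f ∧ Measurable b ∧
          Tendsto f (𝓝[>] (0 : ℝ)) (𝓝 0) ∧ Tendsto b (𝓝[>] (0 : ℝ)) (𝓝 0) ∧
          (∀ u ∈ Set.Ioo (0 : ℝ) 1, IntegrableOn (fun t => b t / t) (Set.Ioc u 1)) ∧
          (∀ u ∈ Set.Ioo (0 : ℝ) 1,
            upEnd F - genInv F (1 - u) =
              c * (1 + f u) * u ^ (1 / γ) * Real.exp (∫ t in u..1, b t / t))) := by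
  obtain ⟨hbdd, A, hA, hAr, hV⟩ := types_lemma hF hγ h
  have hd : 0 < 1 / γ := by positivity
  set d := 1 / γ with hdd
  have hl2 : 0 < Real.log 2 := Real.log_pos (by norm_num)
  set β : ℕ → ℝ := fun k => d + (Real.log (A (k + 1)) - Real.log (A k)) / Real.log 2 with hβ
  have hβe : ∀ k, β k * Real.log 2 = d * Real.log 2 + Real.log (A (k + 1)) - Real.log (A k) := by
    intro k; simp only [hβ]; field_simp; ring
  have hβ0 : Tendsto β atTop (𝓝 0) := by
    have hpos : (0:ℝ) < (1 / 2) ^ d := by positivity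
    have h1 := ((Real.continuousAt_log hpos.ne').tendsto.comp hAr).div_const (Real.log 2)
    have h2 := h1.const_add d
    have e : d + Real.log ((1 / 2) ^ d) / Real.log 2 = 0 := by
      rw [Real.log_rpow (by norm_num), one_div (2:ℝ), Real.log_inv]; field_simp; ring
    rw [e] at h2
    refine h2.congr fun k => ?_
    simp only [hβ, Function.comp, Real.log_div (hA (k + 1)).ne' (hA k).ne']
  obtain ⟨M, hM⟩ : ∃ M, ∀ k, |β k| ≤ M := by
    obtain ⟨M, hM⟩ := (Metric.isBounded_range_of_tendsto _ hβ0).exists_norm_le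
    exact ⟨M, fun k => hM _ ⟨k, rfl⟩⟩
  set D : ℝ → ℝ := fun u => A (kap u) * (u * 2 ^ kap u) ^ (d - β (kap u)) with hD
  have hDpos : ∀ u ∈ Ioo (0:ℝ) 1, 0 < D u := by
    intro u hu
    have := hu.1
    have := hA (kap u)
    simp only [hD]; positivity
  have hDm : Measurable D := by
    have m1 : Measurable (fun u => A (kap u)) := measurable_from_nat.comp kap_meas
    have m2 : Measurable (fun u => d - β (kap u)) :=
      (measurable_from_nat (f := fun k => d - β k)).comp kap_meas
    have m3 : Measurable (fun u => (2:ℝ) ^ (kap u)) :=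
      (measurable_from_nat (f := fun k => (2:ℝ) ^ k)).comp kap_meas
    exact m1.mul ((measurable_id.mul m3).pow m2)
  refine ⟨hbdd, A 0, hA 0,
    fun u => (Ioo (0:ℝ) 1).indicator (fun u => (upEnd F - genInv F (1 - u)) / D u - 1) u,
    fun t => β (kap t), quot_meas hF hDm _, (measurable_from_nat (f := β)).comp kap_meas, ?_,
    hβ0.comp kap_tendsto, fun u hu => rep_integrable hM hu.1, ?_⟩
  · have u1 : TendstoUniformlyOn (fun (k : ℕ) y => (upEnd F - genInv F (1 - y / 2 ^ k)) / A k)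
        (fun y => y ^ d) atTop (Icc (1 / 2) 1) := by
      refine mono_unif ?_ (fun y hy => hV y hy.1)
        (fun y hy => Real.continuousAt_rpow_const _ _ (Or.inl hy.1.ne'))
      filter_upwards [eventually_ge_atTop 1] with k hk x hx y hy hxy
      have hp : (2:ℝ) ≤ 2 ^ k := by
        calc (2:ℝ) = 2 ^ 1 := by norm_num
          _ ≤ 2 ^ k := pow_le_pow_right₀ (by norm_num) hk
      have hpp : (0:ℝ) < 2 ^ k := by positivity
      have q1 : y / 2 ^ k < 1 := by rw [div_lt_one hpp]; linarith [hy.2]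
      have q2 : 0 < x / 2 ^ k := div_pos hx.1 hpp
      have q3 : x / 2 ^ k ≤ y / 2 ^ k := by gcongr
      have q4 := genInv_mono hF (p := 1 - y / 2 ^ k) (q := 1 - x / 2 ^ k) (by linarith)
        (by linarith) (by linarith)
      have := hA k
      dsimp only
      gcongr
    have hδ : Tendsto (fun k => d - β k) atTop (𝓝 d) := by simpa using hβ0.const_sub d
    have u2 : TendstoUniformlyOn (fun (k : ℕ) (y : ℝ) => y ^ (d - β k))
        (fun y => y ^ d) atTop (Icc (1 / 2) 1) := by
      refine mono_unif ?_ (fun y hy => ?_)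
        (fun y hy => Real.continuousAt_rpow_const _ _ (Or.inl hy.1.ne'))
      · filter_upwards [hδ.eventually (lt_mem_nhds hd)] with k hk x hx y hy hxy
        exact Real.rpow_le_rpow hx.1.le hxy hk.le
      · exact tendsto_const_nhds.rpow hδ (Or.inl hy.1.ne')
    rw [Metric.tendstoUniformlyOn_iff] at u1 u2
    set m : ℝ := (1 / 2) ^ d with hm
    have hmpos : 0 < m := by positivity
    rw [Metric.tendsto_nhds]
    intro ε hε
    set η := min (m / 2) (ε * m / 8) with hη
    have hη0 : 0 < η := by positivity
    have hη1 : η ≤ m / 2 := min_le_left _ _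
    have hη2 : η ≤ ε * m / 8 := min_le_right _ _
    have hu01 : ∀ᶠ u in 𝓝[>] (0:ℝ), u ∈ Ioo (0:ℝ) 1 := Ioo_mem_nhdsGT one_pos
    filter_upwards [kap_tendsto.eventually (u1 η hη0), kap_tendsto.eventually (u2 η hη0), hu01]
      with u v1 v2 hu
    obtain ⟨s1, s2⟩ := kap_spec hu.1 hu.2.le
    have w1 := v1 (u * 2 ^ kap u) ⟨s1.le, s2⟩
    have w2 := v2 (u * 2 ^ kap u) ⟨s1.le, s2⟩
    rw [mul_div_cancel_right₀ u (by positivity : (2:ℝ) ^ kap u ≠ 0)] at w1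
    have w3 : m ≤ (u * 2 ^ kap u) ^ d := Real.rpow_le_rpow (by norm_num) s1.le hd.le
    rw [indicator_of_mem hu, Real.dist_eq, sub_zero]
    simp only [hD]
    rw [← div_div]
    generalize (upEnd F - genInv F (1 - u)) / A (kap u) = G at w1 ⊢
    generalize (u * 2 ^ kap u) ^ (d - β (kap u)) = P at w2 ⊢
    generalize (u * 2 ^ kap u) ^ d = Q at w1 w2 w3
    rw [Real.dist_eq, abs_lt] at w1 w2
    have hP : m / 2 ≤ P := by linarith [w2.2]
    have hP0 : 0 < P := by linarith
    rw [div_sub_one hP0.ne', abs_div, abs_of_pos hP0, div_lt_iff₀ hP0, abs_lt]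
    constructor <;> nlinarith [w1.1, w1.2, w2.1, w2.2]
  · intro u hu
    have e := rep_formula (d := d) hA hM hβe hu.1 hu.2.le
    have hp := hDpos u hu
    beta_reduce
    rw [indicator_of_mem hu]
    calc upEnd F - genInv F (1 - u) = (1 + ((upEnd F - genInv F (1 - u)) / D u - 1)) * D u := by
          field_simp; ring
      _ = (1 + ((upEnd F - genInv F (1 - u)) / D u - 1)) *
          (A 0 * u ^ d * Real.exp (∫ t in u..1, β (kap t) / t)) := by rw [e]
      _ = _ := by ring

/-- Karamata representation for the Weibull domain. -/
theorem weibull_karamata_representation (F : ℝ → ℝ) (hF : IsDF F) (γ : ℝ) (hγ : 0 < γ) :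
    MemDomAttr F (weibullDF γ) ↔
      (BddAbove {x | F x < 1} ∧
        ∃ c : ℝ, 0 < c ∧ ∃ f b : ℝ → ℝ, Measurable f ∧ Measurable b ∧
          Tendsto f (𝓝[>] (0 : ℝ)) (𝓝 0) ∧ Tendsto b (𝓝[>] (0 : ℝ)) (𝓝 0) ∧
          (∀ u ∈ Set.Ioo (0 : ℝ) 1, IntegrableOn (fun t => b t / t) (Set.Ioc u 1)) ∧
          (∀ u ∈ Set.Ioo (0 : ℝ) 1,
            upEnd F - genInv F (1 - u) =
              c * (1 + f u) * u ^ (1 / γ) * Real.exp (∫ t in u..1, b t / t))) := by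
  constructor
  · intro h
    exact forward_dir hF hγ h
  · rintro ⟨hbdd, c, hc, f, b, -, -, hf, hb, hint, hV⟩
    have h := rep_rv (V := fun u => upEnd F - genInv F (1 - u)) hc hf hb hint hV
    exact converse_dir hF hγ hbdd (fun u _ => rfl) h.1 h.2

end
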